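/- Let k be a field and let t ≤ min{p,q} be positive integers. Let X = (x_{ij}) be a p×q matrix of indeterminates, R = k[x_{ij} : 1 ≤ i ≤ p, 1 ≤ j ≤ q] the polynomial ring with maximal homogeneous ideal 𝔪, and I = I_t(X) the ideal of R generated by the determinants of all t×t submatrices of X. Set h = (p−t+1)(q−t+1). Then for all integers m, r ≥ 1 one has the containment I^{(r(h+m−1))} ⊆ 𝔪^{r(h−1)} · (I^{(m)})^r. -/

import Mathlib

/-- The `n`-th symbolic power of an ideal `I`:
`f ∈ I^{(n)}` iff for every associated prime `P` of `R/I` there is `s ∉ P` with `s*f ∈ I^n`.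
(For a prime ideal `I` this is exactly `{f | ∃ s ∉ I, s*f ∈ I^n} = Iⁿ R_I ∩ R`.) -/
def symbolicPower {R : Type*} [CommRing R] (I : Ideal R) (n : ℕ) : Ideal R where
  carrier := {f | ∀ P ∈ associatedPrimes R (R ⧸ I), ∃ s, s ∉ P ∧ s * f ∈ I ^ n}
  zero_mem' := by
    intro P hP
    exact ⟨1, fun h => hP.1.ne_top ((Ideal.eq_top_iff_one P).mpr h), by simp⟩
  add_mem' := by
    intro a b ha hb P hP
    obtain ⟨s, hs, hsa⟩ := ha P hP
    obtain ⟨t, ht, htb⟩ := hb P hP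
    refine ⟨s * t, fun h => ((hP.1.mem_or_mem h).elim hs ht), ?_⟩
    have heq : s * t * (a + b) = t * (s * a) + s * (t * b) := by ring
    rw [heq]
    exact Ideal.add_mem _ (Ideal.mul_mem_left _ _ hsa) (Ideal.mul_mem_left _ _ htb)
  smul_mem' := by
    intro r a ha P hP
    obtain ⟨s, hs, hsa⟩ := ha P hP
    refine ⟨s, hs, ?_⟩
    have heq : s * (r • a) = r * (s * a) := by rw [smul_eq_mul]; ring
    rw [heq]
    exact Ideal.mul_mem_left _ _ hsa

/-- The set of `t×t` minors of the generic `p×q` matrix `X = (x_{ij})` of indeterminates: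
determinants of submatrices obtained by choosing `t` rows and `t` columns. -/
def genericMinors (k : Type*) [Field k] (p q t : ℕ) :
    Set (MvPolynomial (Fin p × Fin q) k) :=
  {f | ∃ (ri : Fin t → Fin p) (ci : Fin t → Fin q),
    Function.Injective ri ∧ Function.Injective ci ∧
      f = Matrix.det (Matrix.of fun a b : Fin t => MvPolynomial.X (ri a, ci b))}

open Finset in
@[to_additive]
theorem Finset.prod_update_update {ι X M : Type*} [Fintype ι] [DecidableEq ι] [CommMonoid M]
    (F : ι → X → M) (c : ι → X) {j j' : ι} (h : j ≠ j') (a b : X) :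
    ∏ x, F x (Function.update (Function.update c j a) j' b x) =
      F j a * F j' b * ∏ x ∈ (univ.erase j).erase j', F x (c x) := by
  rw [← mul_prod_erase univ _ (mem_univ j),
    ← mul_prod_erase (univ.erase j) _ (mem_erase.2 ⟨h.symm, mem_univ j'⟩), ← mul_assoc]
  congr 1
  · simp [h]
  · refine prod_congr rfl fun x hx => ?_
    simp only [mem_erase, mem_univ, and_true, ne_eq] at hx
    simp [hx.1, hx.2]

/-- The alternating map obtained by fixing the arguments outside `P`. -/
def AlternatingMap.restrictArgs {R M N ι : Type*} [CommRing R] [AddCommGroup M] [Module R M]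
    [AddCommGroup N] [Module R N] (f : M [⋀^ι]→ₗ[R] N) (P : ι → Prop) [DecidablePred P]
    (z : ι → M) : M [⋀^{a // P a}]→ₗ[R] N :=
  { f.toMultilinearMap.domDomRestrict P (fun a => z a) with
    map_eq_zero_of_eq' := by
      intro v i j hv hij
      refine f.map_eq_zero_of_eq _ (i := i) (j := j) ?_ (fun h => hij (Subtype.ext h))
      simp [i.2, j.2, hv] }

theorem AlternatingMap.restrictArgs_apply {R M N ι : Type*} [CommRing R] [AddCommGroup M]
    [Module R M] [AddCommGroup N] [Module R N] (f : M [⋀^ι]→ₗ[R] N) (P : ι → Prop)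
    [DecidablePred P] (z : ι → M) (y : {a // P a} → M) :
    f.restrictArgs P z y = f (fun j => if h : P j then y ⟨j, h⟩ else z j) := rfl

/-- The Garnir (shuffle) relation, as a membership statement: if `ιa ⊕ ιb` has more elements than
the dimension, then `α(y) β(y)` is a signed sum of its proper shuffles. -/
theorem AlternatingMap.mul_mem_of_shuffles {R : Type*} [CommRing R] {p : ℕ} {ιa ιb : Type*}
    [Fintype ιa] [Fintype ιb] [DecidableEq ιa] [DecidableEq ιb]
    (α : (Fin p → R) [⋀^ιa]→ₗ[R] R) (β : (Fin p → R) [⋀^ιb]→ₗ[R] R)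
    (hcard : p < Fintype.card ιa + Fintype.card ιb) (y : ιa ⊕ ιb → Fin p → R)
    (W : AddSubgroup R)
    (hW : ∀ σ : Equiv.Perm (ιa ⊕ ιb), (∃ l r, σ (Sum.inl l) = Sum.inr r) →
      α (fun l => y (σ (Sum.inl l))) * β (fun l => y (σ (Sum.inr l))) ∈ W) :
    α (fun l => y (Sum.inl l)) * β (fun l => y (Sum.inr l)) ∈ W := by
  have hzero : α.domCoprod β = 0 := by
    refine Module.Basis.ext_alternating (Pi.basisFun R (Fin p)) fun v hv => ?_
    have := Fintype.card_le_of_injective v hv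
    simp at this
    omega
  have h0 := congrArg (fun f => LinearMap.mul' R R (f y)) hzero
  simp only [AlternatingMap.domCoprod_apply, sum_apply, map_sum, AlternatingMap.zero_apply] at h0
  replace h0 := h0.trans (LinearMap.mul' R R).map_zero
  have hsummand : ∀ σ : Equiv.Perm (ιa ⊕ ιb),
      LinearMap.mul' R R (AlternatingMap.domCoprod.summand α β (Quotient.mk'' σ) y) =
        Equiv.Perm.sign σ •
          (α (fun l => y (σ (Sum.inl l))) * β (fun l => y (σ (Sum.inr l)))) := by
    intro σ
    rw [AlternatingMap.domCoprod.summand_mk'']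
    rcases Int.units_eq_one_or (Equiv.Perm.sign σ) with h | h <;> simp [h]
  classical
  replace h0 := (Finset.add_sum_erase _ _ (Finset.mem_univ
    (Quotient.mk'' 1 : Equiv.Perm.ModSumCongr ιa ιb))).trans h0
  rw [hsummand, Equiv.Perm.sign_one, one_smul] at h0
  simp only [Equiv.Perm.coe_one, id_eq] at h0
  rw [eq_neg_of_add_eq_zero_left h0]
  refine W.neg_mem (W.sum_mem fun τ hτ => ?_)
  induction τ using Quotient.inductionOn' with | _ σ
  rw [hsummand]
  have hσ : ∃ l r, σ (Sum.inl l) = Sum.inr r := by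
    by_contra! hcon
    refine (Finset.mem_erase.1 hτ).1 (Quotient.sound' ?_)
    rw [QuotientGroup.leftRel_apply, mul_one]
    refine inv_mem (Equiv.Perm.mem_sumCongrHom_range_of_perm_mapsTo_inl ?_)
    rintro _ ⟨l, rfl⟩
    rcases h : σ (Sum.inl l) with l' | r
    · exact ⟨l', rfl⟩
    · exact absurd h (hcon l r)
  rcases Int.units_eq_one_or (Equiv.Perm.sign σ) with h | h
  · simpa [h] using hW σ hσ
  · simpa [h] using hW σ hσ

theorem sum_comp_perm_inl_le {ιa ιb : Type*} [Fintype ιa] [Fintype ιb] (F : ιa ⊕ ιb → ℤ) (θ : ℤ)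
    (ha : ∀ l, θ ≤ F (Sum.inl l)) (hb : ∀ r, F (Sum.inr r) ≤ θ) (σ : Equiv.Perm (ιa ⊕ ιb)) :
    ∑ l, F (σ (Sum.inl l)) ≤ ∑ l, F (Sum.inl l) ∧
      ((∃ l r, σ (Sum.inl l) = Sum.inr r ∧ F (Sum.inr r) < θ) →
        ∑ l, F (σ (Sum.inl l)) < ∑ l, F (Sum.inl l)) := by
  have key : ∑ l, max (F (σ (Sum.inl l)) - θ) 0 ≤ ∑ l, (F (Sum.inl l) - θ) := by
    have h1 : ∑ x, max (F (σ x) - θ) 0 = ∑ x, max (F x - θ) 0 :=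
      Equiv.sum_comp σ fun x => max (F x - θ) 0
    rw [Fintype.sum_sum_type, Fintype.sum_sum_type] at h1
    have h2 : ∑ r, max (F (Sum.inr r) - θ) 0 = 0 :=
      Finset.sum_eq_zero fun r _ => max_eq_right (by linarith [hb r])
    have h3 : ∑ l, max (F (Sum.inl l) - θ) 0 = ∑ l, (F (Sum.inl l) - θ) :=
      Finset.sum_congr rfl fun l _ => max_eq_left (by linarith [ha l])
    have h4 : 0 ≤ ∑ r, max (F (σ (Sum.inr r)) - θ) 0 :=
      Finset.sum_nonneg fun r _ => le_max_right _ _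
    linarith
  have hsub : ∀ G : ιa → ℤ, ∑ l, (G l - θ) = ∑ l, G l - ∑ _l : ιa, θ := fun G =>
    Finset.sum_sub_distrib _ _
  constructor
  · have : ∑ l, (F (σ (Sum.inl l)) - θ) ≤ ∑ l, max (F (σ (Sum.inl l)) - θ) 0 :=
      Finset.sum_le_sum fun l _ => le_max_left _ _
    rw [hsub] at this key
    linarith
  · rintro ⟨l₀, r, hσ, hr⟩
    have : ∑ l, (F (σ (Sum.inl l)) - θ) < ∑ l, max (F (σ (Sum.inl l)) - θ) 0 :=
      Finset.sum_lt_sum (fun l _ => le_max_left _ _)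
        ⟨l₀, Finset.mem_univ _, lt_of_lt_of_le (by rw [hσ]; linarith) (le_max_right _ _)⟩
    rw [hsub] at this key
    linarith

/-- The maximal minor of `Z` on the columns `c`. -/
def colMinor {R : Type*} [CommRing R] {p n : ℕ} (Z : Matrix (Fin p) (Fin n) R)
    (c : Fin p → Fin n) : R :=
  (Z.submatrix id c).det

/-- The number of columns of `c` among the first `q`. -/
def colCount {p n : ℕ} (q : ℕ) (c : Fin p → Fin n) : ℕ := ∑ i, if (c i : ℕ) < q then 1 else 0

/-- The excess of the size `colCount q c` over `t - 1`. -/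
def excess {p n : ℕ} (t q : ℕ) (c : Fin p → Fin n) : ℕ := colCount q c + 1 - t

section Straightening

variable {R : Type*} [CommRing R] {p n : ℕ} (Z : Matrix (Fin p) (Fin n) R)

theorem colMinor_eq_detRowAlternating (c : Fin p → Fin n) :
    colMinor Z c = Matrix.detRowAlternating (fun l i => Z i (c l)) := by
  rw [colMinor, ← Matrix.det_transpose]
  rfl

theorem colMinor_comp_perm (c : Fin p → Fin n) (σ : Equiv.Perm (Fin p)) :
    colMinor Z (c ∘ σ) = ((Equiv.Perm.sign σ : ℤ) : R) * colMinor Z c :=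
  Matrix.det_permute' σ (Z.submatrix id c)

theorem colMinor_eq_zero_of_not_injective {c : Fin p → Fin n} (hc : ¬ Function.Injective c) :
    colMinor Z c = 0 := by
  simp only [Function.Injective, not_forall] at hc
  obtain ⟨i, j, hij, hne⟩ := hc
  exact Matrix.det_zero_of_column_eq hne fun k => by simp [hij]

theorem colMinor_exchange (q : ℕ) {a b : Fin p → Fin n} (ha : StrictMono a) (hb : StrictMono b)
    (i : Fin p) (hi : b i < a i) (W : AddSubgroup R)
    (hW : ∀ a' b' : Fin p → Fin n,
      (∀ f : Fin n → ℕ, ∑ l, f (a' l) + ∑ l, f (b' l) = ∑ l, f (a l) + ∑ l, f (b l)) →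
      (∀ f : Fin n → ℕ, StrictMono f → ∑ l, f (a' l) < ∑ l, f (a l)) →
      colCount q a ≤ colCount q a' → colMinor Z a' * colMinor Z b' ∈ W) :
    colMinor Z a * colMinor Z b ∈ W := by
  let α := (Matrix.detRowAlternating (n := Fin p) (R := R)).restrictArgs (fun l => i ≤ l)
    (fun l k => Z k (a l))
  let β := (Matrix.detRowAlternating (n := Fin p) (R := R)).restrictArgs (fun l => l ≤ i)
    (fun l k => Z k (b l))
  let y : {l // i ≤ l} ⊕ {l // l ≤ i} → Fin n := Sum.elim (fun l => a l) (fun l => b l)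
  let a' : Equiv.Perm ({l // i ≤ l} ⊕ {l // l ≤ i}) → Fin p → Fin n := fun σ l =>
    if h : i ≤ l then y (σ (Sum.inl ⟨l, h⟩)) else a l
  let b' : Equiv.Perm ({l // i ≤ l} ⊕ {l // l ≤ i}) → Fin p → Fin n := fun σ l =>
    if h : l ≤ i then y (σ (Sum.inr ⟨l, h⟩)) else b l
  have hα : ∀ σ : Equiv.Perm ({l // i ≤ l} ⊕ {l // l ≤ i}),
      α (fun l k => Z k (y (σ (Sum.inl l)))) = colMinor Z (a' σ) := by
    intro σ
    rw [colMinor_eq_detRowAlternating, AlternatingMap.restrictArgs_apply]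
    congr 1
    funext l k
    by_cases h : i ≤ l <;> simp [a', h]
  have hβ : ∀ σ : Equiv.Perm ({l // i ≤ l} ⊕ {l // l ≤ i}),
      β (fun l k => Z k (y (σ (Sum.inr l)))) = colMinor Z (b' σ) := by
    intro σ
    rw [colMinor_eq_detRowAlternating, AlternatingMap.restrictArgs_apply]
    congr 1
    funext l k
    by_cases h : l ≤ i <;> simp [b', h]
  have ha1 : a' 1 = a := by
    funext l
    by_cases h : i ≤ l <;> simp [a', y, h]
  have hb1 : b' 1 = b := by
    funext l
    by_cases h : l ≤ i <;> simp [b', y, h]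
  have hsplit_a : ∀ (g : Fin n → ℕ) (σ), ∑ l, g (a' σ l) =
      ∑ l, g (y (σ (Sum.inl l))) + ∑ l : {l // ¬ i ≤ l}, g (a l) := by
    intro g σ
    rw [← Fintype.sum_subtype_add_sum_subtype (fun l => i ≤ l)]
    congr 1
    · exact Fintype.sum_congr _ _ fun l => by simp [a', l.2]
    · exact Fintype.sum_congr _ _ fun l => by simp only [a', dif_neg l.2]
  have hsplit_b : ∀ (g : Fin n → ℕ) (σ), ∑ l, g (b' σ l) =
      ∑ l, g (y (σ (Sum.inr l))) + ∑ l : {l // ¬ l ≤ i}, g (b l) := by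
    intro g σ
    rw [← Fintype.sum_subtype_add_sum_subtype (fun l => l ≤ i)]
    congr 1
    · exact Fintype.sum_congr _ _ fun l => by simp [b', l.2]
    · exact Fintype.sum_congr _ _ fun l => by simp only [b', dif_neg l.2]
  have hy_inl : ∀ l, a i ≤ y (Sum.inl l) := fun l => ha.monotone l.2
  have hy_inr : ∀ r, y (Sum.inr r) < a i := fun r => (hb.monotone r.2).trans_lt hi
  have hcard : p < Fintype.card {l // i ≤ l} + Fintype.card {l // l ≤ i} := by
    rw [Fintype.card_subtype, Fintype.card_subtype,
      show (Finset.univ.filter fun l => i ≤ l) = Finset.Ici i by ext; simp,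
      show (Finset.univ.filter fun l => l ≤ i) = Finset.Iic i by ext; simp,
      Fin.card_Ici, Fin.card_Iic]
    omega
  have main := AlternatingMap.mul_mem_of_shuffles α β hcard (fun x k => Z k (y x)) W ?_
  · have h1 := hα 1
    have h2 := hβ 1
    rw [ha1] at h1
    rw [hb1] at h2
    simp only [Equiv.Perm.coe_one, id_eq] at h1 h2
    rwa [h1, h2] at main
  · rintro σ ⟨l₀, r₀, hσ⟩
    rw [hα, hβ]
    refine hW _ _ (fun f => ?_) (fun f hf => ?_) ?_
    · have e1 := hsplit_a f σ
      have e2 := hsplit_b f σ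
      have e3 := hsplit_a f 1
      have e4 := hsplit_b f 1
      have e5 : ∑ x, f (y (σ x)) = ∑ x, f (y x) := Equiv.sum_comp σ fun x => f (y x)
      rw [Fintype.sum_sum_type, Fintype.sum_sum_type] at e5
      rw [ha1] at e3
      rw [hb1] at e4
      simp only [Equiv.Perm.coe_one, id_eq] at e3 e4
      omega
    · have e1 := hsplit_a f σ
      have e3 := hsplit_a f 1
      rw [ha1] at e3
      simp only [Equiv.Perm.coe_one, id_eq] at e3
      have := (sum_comp_perm_inl_le (fun x => (f (y x) : ℤ)) (f (a i))
        (fun l => by exact_mod_cast hf.monotone (hy_inl l))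
        (fun r => by exact_mod_cast (hf (hy_inr r)).le) σ).2
        ⟨l₀, r₀, hσ, by exact_mod_cast hf (hy_inr r₀)⟩
      have h' : ∑ l, f (y (σ (Sum.inl l))) < ∑ l, f (y (Sum.inl l)) := by exact_mod_cast this
      omega
    · let f : Fin n → ℕ := fun v => if (v : ℕ) < q then 1 else 0
      have hf : Antitone f := by
        intro v w hvw
        have : (v : ℕ) ≤ w := hvw
        simp only [f]
        split_ifs <;> omega
      have e1 := hsplit_a f σ
      have e3 := hsplit_a f 1
      rw [ha1] at e3
      simp only [Equiv.Perm.coe_one, id_eq] at e3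
      have := (sum_comp_perm_inl_le (fun x => -(f (y x) : ℤ)) (-(f (a i) : ℤ))
        (fun l => neg_le_neg (by exact_mod_cast hf (hy_inl l)))
        (fun r => neg_le_neg (by exact_mod_cast hf (hy_inr r).le)) σ).1
      rw [Finset.sum_neg_distrib, Finset.sum_neg_distrib, neg_le_neg_iff] at this
      have h' : ∑ l, f (y (Sum.inl l)) ≤ ∑ l, f (y (σ (Sum.inl l))) := by exact_mod_cast this
      change ∑ l, f (a l) ≤ ∑ l, f (a' σ l)
      omega

theorem exists_sorted {d : ℕ} (c : Fin d → Fin p → Fin n)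
    (hc : ∀ j, Function.Injective (c j)) :
    ∃ c' : Fin d → Fin p → Fin n, (∀ j, StrictMono (c' j)) ∧
      (∀ (f : Fin n → ℕ) (j), ∑ i, f (c' j i) = ∑ i, f (c j i)) ∧
      ∀ W : AddSubgroup R, ∏ j, colMinor Z (c' j) ∈ W → ∏ j, colMinor Z (c j) ∈ W := by
  refine ⟨fun j => c j ∘ Tuple.sort (c j), fun j => ?_, fun f j => ?_, fun W hW => ?_⟩
  · exact (Tuple.monotone_sort (c j)).strictMono_of_injective
      ((hc j).comp (Equiv.injective _))
  · exact Equiv.sum_comp (Tuple.sort (c j)) fun i => f (c j i)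
  · simp only [colMinor_comp_perm, Finset.prod_mul_distrib] at hW
    rw [← Int.cast_prod, ← Units.coe_prod] at hW
    rcases Int.units_eq_one_or (∏ j, Equiv.Perm.sign (Tuple.sort (c j))) with h | h
    · simpa [h] using hW
    · simpa [h] using hW

theorem excess_add_le {t q : ℕ} {a b a' b' : Fin p → Fin n}
    (hsum : colCount q a' + colCount q b' = colCount q a + colCount q b)
    (hab : colCount q b ≤ colCount q a) (haa' : colCount q a ≤ colCount q a') :
    excess t q a + excess t q b ≤ excess t q a' + excess t q b' := by
  unfold excess
  omega

/-- Straightening: a product of maximal minors lies in every additive subgroup containing the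
standard products whose total excess is at least as large. -/
theorem prod_colMinor_mem_of_standard {t q d N : ℕ} (W : AddSubgroup R)
    (hW : ∀ e : Fin d → Fin p → Fin n, Monotone e → (∀ j, StrictMono (e j)) →
      N ≤ ∑ j, excess t q (e j) → ∏ j, colMinor Z (e j) ∈ W)
    (c : Fin d → Fin p → Fin n) (hN : N ≤ ∑ j, excess t q (c j)) :
    ∏ j, colMinor Z (c j) ∈ W := by
  let val : Fin n → ℕ := fun v => v + if (v : ℕ) < q then 0 else p * n + 1
  have hval : StrictMono val := by
    intro v w hvw
    have : (v : ℕ) < w := hvw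
    simp only [val]
    split_ifs <;> omega
  let vsum : (Fin p → Fin n) → ℕ := fun c => ∑ i, val (c i)
  have hvsum : ∀ a b : Fin p → Fin n, colCount q a < colCount q b → vsum b < vsum a := by
    intro a b hab
    have hv : ∀ c : Fin p → Fin n,
        vsum c + (p * n + 1) * colCount q c = ∑ i, (c i : ℕ) + p * (p * n + 1) := by
      intro c
      have h1 : ∑ _i : Fin p, (p * n + 1) = p * (p * n + 1) := by simp
      rw [← h1, colCount, Finset.mul_sum, ← Finset.sum_add_distrib, ← Finset.sum_add_distrib]
      refine Finset.sum_congr rfl fun i _ => ?_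
      simp only [val]
      split_ifs <;> omega
    have hb : ∑ i, (b i : ℕ) ≤ p * n := by
      simpa using Finset.sum_le_card_nsmul Finset.univ (fun i => (b i : ℕ)) n
        fun i _ => (b i).2.le
    have h1 := hv a
    have h2 := hv b
    have h3 : (p * n + 1) * (colCount q a + 1) ≤ (p * n + 1) * colCount q b :=
      Nat.mul_le_mul_left _ hab
    rw [mul_add] at h3
    omega
  induction hw : ∑ j, (d - j) * vsum (c j) using Nat.strong_induction_on generalizing c with
  | _ w ih =>
  by_cases hinj : ∀ j, Function.Injective (c j)
  swap
  · push Not at hinj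
    obtain ⟨j, hj⟩ := hinj
    rw [Finset.prod_eq_zero (Finset.mem_univ j) (colMinor_eq_zero_of_not_injective Z hj)]
    exact W.zero_mem
  obtain ⟨c', hmono, hsum, hmem⟩ := exists_sorted Z c hinj
  refine hmem W ?_
  have hN' : N ≤ ∑ j, excess t q (c' j) := by
    refine hN.trans_eq (Finset.sum_congr rfl fun j _ => ?_)
    unfold excess colCount
    rw [hsum (fun v => if (v : ℕ) < q then 1 else 0) j]
  have hw' : ∑ j, (d - j) * vsum (c' j) = w := by
    rw [← hw]
    exact Finset.sum_congr rfl fun j _ => by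
      rw [show vsum (c' j) = vsum (c j) from hsum val j]
  clear hmem hN hw hinj
  by_cases hstd : Monotone c'
  · exact hW c' hstd hmono hN'
  have : ∃ j j', j < j' ∧ ∃ i, c' j' i < c' j i := by
    simp only [Monotone, not_forall] at hstd
    obtain ⟨j, j', hle, hnot⟩ := hstd
    rw [Pi.le_def] at hnot
    push Not at hnot
    refine ⟨j, j', lt_of_le_of_ne hle ?_, hnot⟩
    rintro rfl
    obtain ⟨i, hi⟩ := hnot
    exact lt_irrefl _ hi
  obtain ⟨j, j', hjj', i, hi⟩ := this
  have hself : Function.update (Function.update c' j (c' j)) j' (c' j') = c' := by simp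
  have step : ∀ a b : Fin p → Fin n, vsum a < vsum (c' j) →
      vsum a + vsum b = vsum (c' j) + vsum (c' j') →
      excess t q (c' j) + excess t q (c' j') ≤ excess t q a + excess t q b →
      colMinor Z a * colMinor Z b * ∏ x ∈ (Finset.univ.erase j).erase j', colMinor Z (c' x) ∈ W := by
    intro a b hlt hadd hexc
    rw [← Finset.prod_update_update (fun _ => colMinor Z) c' hjj'.ne a b]
    refine ih _ ?_ _ ?_ rfl
    · rw [← hw', Finset.sum_update_update (fun (x : Fin d) v => (d - (x : ℕ)) * vsum v) c' hjj'.ne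
          a b,
        ← hself, Finset.sum_update_update (fun (x : Fin d) v => (d - (x : ℕ)) * vsum v) c' hjj'.ne,
        hself]
      have h1 : d - (j' : ℕ) < d - (j : ℕ) := by
        have : (j : ℕ) < j' := hjj'
        omega
      obtain ⟨e, he⟩ := Nat.exists_eq_add_of_lt h1
      obtain ⟨e', he'⟩ := Nat.exists_eq_add_of_lt hlt
      rw [he]
      have hb : vsum b = vsum (c' j') + (e' + 1) := by omega
      rw [he', hb]
      nlinarith [Nat.zero_le (e * e')]
    · refine hN'.trans ?_
      rw [Finset.sum_update_update (fun _ => excess t q) c' hjj'.ne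
          a b,
        ← hself, Finset.sum_update_update (fun _ => excess t q) c' hjj'.ne,
        hself]
      omega
  rw [← hself, Finset.prod_update_update (fun _ => colMinor Z) c' hjj'.ne]
  rcases lt_or_ge (colCount q (c' j)) (colCount q (c' j')) with hlt | hge
  · rw [mul_comm (colMinor Z (c' j))]
    exact step _ _ (hvsum _ _ hlt) (add_comm _ _) (add_comm _ _).le
  · refine colMinor_exchange Z q (hmono j) (hmono j') i hi
      (W.comap (AddMonoidHom.mulRight
        (∏ x ∈ (Finset.univ.erase j).erase j', colMinor Z (c' x)))) ?_
    intro a' b' hsum' hlt hcount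
    exact step _ _ (hlt val hval) (hsum' val) 
      (excess_add_le (hsum' fun v => if (v : ℕ) < q then 1 else 0) hge hcount)

end Straightening

open MvPolynomial in
theorem MonomialOrder.exists_degree_eq_of_mem_span {σ k ι M : Type*} [Field k] [AddCommGroup M]
    [Module k M] (m : MonomialOrder σ) (φ : M →ₗ[k] MvPolynomial σ k) (T : ι → M) (s : Set ι)
    (hne : ∀ i ∈ s, φ (T i) ≠ 0) (hinj : Set.InjOn (fun i => m.degree (φ (T i))) s)
    {F : M} (hF : F ∈ Submodule.span k (T '' s)) (hF0 : F ≠ 0) :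
    φ F ≠ 0 ∧ ∃ i ∈ s, m.degree (φ F) = m.degree (φ (T i)) := by
  obtain ⟨l, hl, rfl⟩ := (Finsupp.mem_span_image_iff_linearCombination k).1 hF
  have hsupp : ∀ i ∈ l.support, i ∈ s := fun i hi => hl hi
  have hl0 : l.support.Nonempty := by
    rw [Finsupp.support_nonempty_iff]
    rintro rfl
    simp at hF0
  obtain ⟨i, hi, hmax⟩ :=
    Finset.exists_max_image l.support (fun i => m.toSyn (m.degree (φ (T i)))) hl0
  have hli : l i ≠ 0 := Finsupp.mem_support_iff.1 hi
  have hco : ∀ j ∈ l.support, j ≠ i → (φ (T j)).coeff (m.degree (φ (T i))) = 0 := by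
    intro j hj hji
    refine m.coeff_eq_zero_of_lt (lt_of_le_of_ne (hmax j hj) fun h => hji ?_)
    exact hinj (hsupp j hj) (hsupp i hi) (m.toSyn.injective h)
  have hφ : φ (Finsupp.linearCombination k T l) = ∑ j ∈ l.support, l j • φ (T j) := by
    rw [Finsupp.linearCombination_apply, Finsupp.sum, map_sum]
    simp
  have hcoeff : (φ (Finsupp.linearCombination k T l)).coeff (m.degree (φ (T i))) ≠ 0 := by
    rw [hφ, coeff_sum, Finset.sum_eq_single i]
    · rw [coeff_smul, smul_eq_mul]
      exact mul_ne_zero hli (m.coeff_degree_ne_zero_iff.2 (hne i (hsupp i hi)))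
    · intro j hj hji
      rw [coeff_smul, hco j hj hji, smul_zero]
    · exact fun h => absurd hi h
  refine ⟨fun h => hcoeff (by rw [h, coeff_zero]), i, hsupp i hi, m.toSyn.injective ?_⟩
  refine le_antisymm ?_ (m.le_degree (mem_support_iff.2 hcoeff))
  rw [hφ]
  refine m.degree_sum_le.trans (Finset.sup_le fun j hj => ?_)
  exact m.degree_smul_le.trans (hmax j hj)

theorem StrictMono.val_le_add {p q : ℕ} {c : Fin p → Fin (q + p)} (hc : StrictMono c) (i : Fin p) :
    (c i : ℕ) ≤ q + i := by
  have h := Finset.card_le_card_of_injOn (s := Finset.Ioi i) (t := Finset.Ioi (c i)) c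
    (fun j hj => by simpa using hc (by simpa using hj)) hc.injective.injOn
  rw [Fin.card_Ioi, Fin.card_Ioi] at h
  have := i.2
  omega

theorem eq_of_monotone_of_card_fiber {d : ℕ} {a a' : Fin d → ℕ} (ha : Monotone a)
    (ha' : Monotone a') {B : ℕ} (hB : ∀ j, a j ≤ B) (hB' : ∀ j, a' j ≤ B)
    (h : ∀ v < B, (Finset.univ.filter fun j => a j = v).card =
      (Finset.univ.filter fun j => a' j = v).card) : a = a' := by
  have key : ∀ {a a' : Fin d → ℕ}, Monotone a → Monotone a' → (∀ j, a j ≤ B) → (∀ j, a' j ≤ B) →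
      (∀ v < B, (Finset.univ.filter fun j => a j = v).card =
        (Finset.univ.filter fun j => a' j = v).card) →
      ∀ j, (∀ i < j, a i = a' i) → ¬ a j < a' j := by
    intro a a' ha ha' hB hB' h j hlow hlt
    have hv := h (a j) (hlt.trans_le (hB' j))
    refine absurd hv (Finset.card_lt_card ?_).ne'
    rw [Finset.ssubset_iff_of_subset]
    · exact ⟨j, by simp, by simp [hlt.ne']⟩
    · intro i hi
      simp only [Finset.mem_filter, Finset.mem_univ, true_and] at hi ⊢
      have hij : i < j := by
        by_contra! hji
        have := ha' hji
        omega
      rw [hlow i hij, hi]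
  funext j
  induction j using WellFoundedLT.induction with
  | ind j ih =>
    have h1 := key ha ha' hB hB' h j ih
    have h2 := key ha' ha hB' hB (fun v hv => (h v hv).symm) j fun i hi => (ih i hi).symm
    omega

section LeadingTerms

open MvPolynomial

variable (k : Type*) [Field k] (p q : ℕ)

/-- The generic `p × q` matrix followed by the identity matrix. -/
noncomputable def extGeneric : Matrix (Fin p) (Fin (q + p)) (MvPolynomial (Fin p × Fin q) k) :=
  fun i => Fin.addCases (fun j => X (i, j)) (fun l => if i = l then 1 else 0)

/-- A generic matrix followed by a generic lower unitriangular matrix. -/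
noncomputable def unitriangularExt :
    Matrix (Fin p) (Fin (q + p)) (MvPolynomial (Fin p ×ₗ Fin (q + p)) k) :=
  fun i v => if (v : ℕ) < q + i then X (toLex (i, v)) else if (v : ℕ) = q + i then 1 else 0

theorem det_unitriangularExt_natAdd :
    ((unitriangularExt k p q).submatrix id (Fin.natAdd q)).det = 1 := by
  rw [Matrix.det_of_isLowerTriangular]
  · exact Finset.prod_eq_one fun i _ => by simp [unitriangularExt]
  · intro i j hij
    have : (i : ℕ) < j := hij
    simp only [Matrix.submatrix_apply, unitriangularExt, id_eq, Fin.val_natAdd]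
    rw [if_neg (by omega), if_neg (by omega)]

/-- The substitution `X = B⁻¹ A`, where `[A | B]` is `unitriangularExt`. -/
noncomputable def unitriangularSubst :
    MvPolynomial (Fin p × Fin q) k →ₐ[k] MvPolynomial (Fin p ×ₗ Fin (q + p)) k :=
  aeval fun x => (((unitriangularExt k p q).submatrix id (Fin.natAdd q))⁻¹ *
    (unitriangularExt k p q).submatrix id (Fin.castAdd p)) x.1 x.2

theorem unitriangularSubst_colMinor (c : Fin p → Fin (q + p)) :
    unitriangularSubst k p q (colMinor (extGeneric k p q) c) =
      colMinor (unitriangularExt k p q) c := by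
  set B := (unitriangularExt k p q).submatrix id (Fin.natAdd q) with hB
  have hdet : IsUnit B.det := by rw [det_unitriangularExt_natAdd]; exact isUnit_one
  have hentry : ∀ i v, unitriangularSubst k p q (extGeneric k p q i v) =
      (B⁻¹ * unitriangularExt k p q) i v := by
    intro i v
    induction v using Fin.addCases with
    | left j => simp [extGeneric, unitriangularSubst, Matrix.mul_apply, hB]
    | right l =>
      have h : (B⁻¹ * B) i l = (1 : Matrix _ _ _) i l := by rw [Matrix.nonsing_inv_mul B hdet]
      rw [Matrix.one_apply, Matrix.mul_apply] at h
      rw [extGeneric, Fin.addCases_right, Matrix.mul_apply]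
      refine Eq.trans ?_ h.symm
      split_ifs <;> simp
  have hmap : (unitriangularSubst k p q).mapMatrix ((extGeneric k p q).submatrix id c) =
      B⁻¹ * (unitriangularExt k p q).submatrix id c := by
    ext1 i l
    exact hentry i (c l)
  rw [colMinor, AlgHom.map_det, hmap, Matrix.det_mul, Matrix.det_nonsing_inv,
    det_unitriangularExt_natAdd, Ring.inverse_one, one_mul, colMinor]

/-- The exponent of the diagonal term of `colMinor (unitriangularExt k p q) c`. -/
noncomputable def diagExp {p q : ℕ} (c : Fin p → Fin (q + p)) : (Fin p ×ₗ Fin (q + p)) →₀ ℕ :=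
  Finsupp.equivFunOnFinite.symm fun x =>
    if c (ofLex x).1 = (ofLex x).2 ∧ ((ofLex x).2 : ℕ) < q + (ofLex x).1 then 1 else 0

variable {p q}

theorem diagExp_apply (c : Fin p → Fin (q + p)) (i : Fin p) (v : Fin (q + p)) :
    diagExp c (toLex (i, v)) = if c i = v ∧ (v : ℕ) < q + i then 1 else 0 := rfl

theorem prod_unitriangularExt {c : Fin p → Fin (q + p)} (hc : ∀ i, (c i : ℕ) ≤ q + i) :
    ∏ i, unitriangularExt k p q i (c i) = monomial (diagExp c) 1 := by
  have h1 : ∀ i, unitriangularExt k p q i (c i) =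
      monomial (if (c i : ℕ) < q + i then Finsupp.single (toLex (i, c i)) 1 else 0) 1 := by
    intro i
    have := hc i
    unfold unitriangularExt
    split_ifs with h h' <;> first | rfl | omega
  rw [Finset.prod_congr rfl fun i _ => h1 i, ← monomial_sum_one]
  refine congrArg (fun u => monomial u (1 : k)) (Finsupp.ext fun x => ?_)
  obtain ⟨⟨i, v⟩, rfl⟩ := toLex.surjective x
  rw [diagExp_apply, Finsupp.finsetSum_apply, Finset.sum_eq_single i]
  · by_cases hv : c i = v
    · subst hv
      by_cases h : (c i : ℕ) < q + i <;> simp [h]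
    · by_cases h : (c i : ℕ) < q + i <;> simp [h, hv]
  · intro j _ hj
    by_cases h : (c j : ℕ) < q + j <;> simp [h, hj]
  · simp

theorem diagExp_comp_perm_lt {c : Fin p → Fin (q + p)} (hc : StrictMono c)
    {σ : Equiv.Perm (Fin p)} (hσ : σ ≠ 1) (hcσ : ∀ i, (c (σ i) : ℕ) ≤ q + i) :
    toLex (diagExp (c ∘ σ)) < toLex (diagExp c) := by
  have hex : ∃ i, σ i ≠ i := by
    by_contra! h
    exact hσ (Equiv.ext h)
  obtain ⟨i, hi, hmin⟩ : ∃ i, σ i ≠ i ∧ ∀ j < i, σ j = j := by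
    obtain ⟨i, hi, hmin⟩ := wellFounded_lt.has_min {i | σ i ≠ i} hex
    exact ⟨i, hi, fun j hj => by_contra fun h => hmin j h hj⟩
  have hlt : i < σ i := by
    rcases lt_trichotomy (σ i) i with h | h | h
    · exact absurd (σ.injective (hmin _ h)) hi
    · exact absurd h hi
    · exact h
  have hclt : c i < c (σ i) := hc hlt
  have hclt' : (c i : ℕ) < c (σ i) := hclt
  have := hcσ i
  refine Finsupp.Lex.lt_iff.2 ⟨toLex (i, c i), ?_, ?_⟩
  · intro x hx
    obtain ⟨⟨j, v⟩, rfl⟩ := toLex.surjective x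
    simp only [ofLex_toLex]
    rw [diagExp_apply, diagExp_apply, Function.comp_apply]
    rw [Prod.Lex.toLex_lt_toLex] at hx
    rcases hx with hj | ⟨hj, hv⟩
    · rw [hmin j hj]
    · simp only at hj hv
      subst hj
      rw [if_neg (fun h => (hv.trans hclt).ne' h.1), if_neg (fun h => hv.ne' h.1)]
  · simp only [ofLex_toLex]
    rw [diagExp_apply, diagExp_apply, Function.comp_apply, if_neg (fun h => hclt.ne' h.1),
      if_pos ⟨rfl, by omega⟩]
    exact Nat.one_pos

theorem colMinor_unitriangularExt_leading {c : Fin p → Fin (q + p)} (hc : StrictMono c) :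
    MonomialOrder.lex.degree (colMinor (unitriangularExt k p q) c) = diagExp c ∧
      colMinor (unitriangularExt k p q) c ≠ 0 := by
  have hterm : ∀ σ : Equiv.Perm (Fin p), σ ≠ 1 →
      (∏ i, unitriangularExt k p q i (c (σ i)) = 0) ∨
      (∏ i, unitriangularExt k p q i (c (σ i)) = monomial (diagExp (c ∘ σ)) 1 ∧
        toLex (diagExp (c ∘ σ)) < toLex (diagExp c)) := by
    intro σ hσ
    by_cases h : ∀ i, (c (σ i) : ℕ) ≤ q + i
    · exact Or.inr ⟨prod_unitriangularExt k h, diagExp_comp_perm_lt hc hσ h⟩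
    · push Not at h
      obtain ⟨i, hi⟩ := h
      refine Or.inl (Finset.prod_eq_zero (Finset.mem_univ i) ?_)
      unfold unitriangularExt
      rw [if_neg (by omega), if_neg (by omega)]
  have hdet : colMinor (unitriangularExt k p q) c =
      ∑ σ : Equiv.Perm (Fin p),
        ((Equiv.Perm.sign σ : ℤ) : MvPolynomial (Fin p ×ₗ Fin (q + p)) k) *
          ∏ i, unitriangularExt k p q i (c (σ i)) := by
    rw [colMinor, ← Matrix.det_transpose, Matrix.det_apply']
    rfl
  have hsign : ∀ (σ : Equiv.Perm (Fin p)) (f : MvPolynomial (Fin p ×ₗ Fin (q + p)) k) u,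
      f.coeff u = 0 →
        (((Equiv.Perm.sign σ : ℤ) : MvPolynomial (Fin p ×ₗ Fin (q + p)) k) * f).coeff u = 0 := by
    intro σ f u h
    rcases Int.units_eq_one_or (Equiv.Perm.sign σ) with h' | h' <;> simp [h', h]
  have hcoeff : ∀ u, toLex (diagExp c) ≤ toLex u →
      (colMinor (unitriangularExt k p q) c).coeff u = if u = diagExp c then 1 else 0 := by
    intro u hu
    rw [hdet, coeff_sum, Finset.sum_eq_single 1]
    · simp only [Equiv.Perm.sign_one, Units.val_one, Int.cast_one, one_mul, Equiv.Perm.coe_one,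
        id_eq]
      rw [prod_unitriangularExt k hc.val_le_add, coeff_monomial]
      simp only [eq_comm]
    · intro σ _ hσ
      refine hsign _ _ _ ?_
      rcases hterm σ hσ with h | ⟨h, hlt⟩
      · rw [h, coeff_zero]
      · rw [h, coeff_monomial, if_neg]
        rintro rfl
        exact absurd hu (not_le.2 hlt)
    · simp
  have h1 : (colMinor (unitriangularExt k p q) c).coeff (diagExp c) = 1 := by
    simp [hcoeff _ le_rfl]
  have hne : colMinor (unitriangularExt k p q) c ≠ 0 := fun h => by simp [h] at h1
  refine ⟨MonomialOrder.lex.toSyn.injective (le_antisymm ?_ ?_), hne⟩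
  · rw [MonomialOrder.degree_le_iff]
    intro u hu
    rw [MonomialOrder.lex_le_iff]
    by_contra! hlt
    rw [mem_support_iff, hcoeff u hlt.le, if_neg] at hu
    · exact hu rfl
    · rintro rfl
      exact lt_irrefl _ hlt
  · exact MonomialOrder.lex.le_degree (mem_support_iff.2 (by rw [h1]; exact one_ne_zero))

/-- Standard tableaux: `d` strictly increasing rows, increasing componentwise. -/
def IsStandard {d p n : ℕ} (e : Fin d → Fin p → Fin n) : Prop :=
  Monotone e ∧ ∀ j, StrictMono (e j)

theorem prod_colMinor_leading {d : ℕ} {e : Fin d → Fin p → Fin (q + p)} (he : IsStandard e) :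
    MonomialOrder.lex.degree (unitriangularSubst k p q (∏ j, colMinor (extGeneric k p q) (e j))) =
        ∑ j, diagExp (e j) ∧
      unitriangularSubst k p q (∏ j, colMinor (extGeneric k p q) (e j)) ≠ 0 := by
  have h := fun j => colMinor_unitriangularExt_leading k (he.2 j)
  rw [map_prod]
  simp only [unitriangularSubst_colMinor]
  refine ⟨?_, Finset.prod_ne_zero_iff.2 fun j _ => (h j).2⟩
  rw [MonomialOrder.degree_prod fun j _ => (h j).2]
  exact Finset.sum_congr rfl fun j _ => (h j).1

theorem sum_diagExp_injOn {d : ℕ} :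
    Set.InjOn (fun e : Fin d → Fin p → Fin (q + p) => ∑ j, diagExp (e j)) {e | IsStandard e} := by
  intro e he e' he' heq
  funext j i
  have happly : ∀ (e : Fin d → Fin p → Fin (q + p)) (v : Fin (q + p)), (v : ℕ) < q + i →
      (∑ j, diagExp (e j)) (toLex (i, v)) =
        (Finset.univ.filter fun j => (e j i : ℕ) = v).card := by
    intro e v hv
    rw [Finsupp.finsetSum_apply, Finset.card_filter]
    refine Finset.sum_congr rfl fun j _ => ?_
    rw [diagExp_apply]
    simp [hv, Fin.ext_iff]
  have := eq_of_monotone_of_card_fiber (a := fun j => (e j i : ℕ)) (a' := fun j => (e' j i : ℕ))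
    (fun _ _ h => he.1 h i) (fun _ _ h => he'.1 h i) (B := q + i)
    (fun j => (he.2 j).val_le_add i) (fun j => (he'.2 j).val_le_add i) ?_
  · exact Fin.ext (congrFun this j)
  · intro v hv
    have hv' : v < q + p := by omega
    rw [← happly e ⟨v, hv'⟩ hv, ← happly e' ⟨v, hv'⟩ hv]
    exact DFunLike.congr_fun heq _

/-- The degree in the variables with row index at least `t - 1` and column index less than `q`. -/
noncomputable def cornerDegree (t : ℕ) (u : (Fin p ×ₗ Fin (q + p)) →₀ ℕ) : ℕ :=
  ∑ i : Fin p, ∑ v : Fin (q + p), if t ≤ i + 1 ∧ (v : ℕ) < q then u (toLex (i, v)) else 0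

theorem cornerDegree_add (t : ℕ) (u u' : (Fin p ×ₗ Fin (q + p)) →₀ ℕ) :
    cornerDegree t (u + u') = cornerDegree t u + cornerDegree t u' := by
  unfold cornerDegree
  simp only [← Finset.sum_add_distrib]
  refine Finset.sum_congr rfl fun i _ => Finset.sum_congr rfl fun v _ => ?_
  split_ifs <;> simp

theorem lt_colCount_iff {n : ℕ} {c : Fin p → Fin n} (hc : StrictMono c) (i : Fin p) :
    (i : ℕ) < colCount q c ↔ (c i : ℕ) < q := by
  have hcard : colCount q c = (Finset.univ.filter fun i => (c i : ℕ) < q).card :=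
    (Finset.card_filter _ _).symm
  rw [hcard]
  constructor
  · intro h
    by_contra! hq
    have := Finset.card_le_card (s := Finset.univ.filter fun i => (c i : ℕ) < q)
      (t := Finset.Iio i) fun j hj => by
        simp only [Finset.mem_filter, Finset.mem_univ, true_and, Finset.mem_Iio] at hj ⊢
        by_contra! hij
        have : (c i : ℕ) ≤ c j := hc.monotone hij
        omega
    rw [Fin.card_Iio] at this
    omega
  · intro h
    have := Finset.card_le_card (t := Finset.univ.filter fun i => (c i : ℕ) < q)
      (s := Finset.Iic i) fun j hj => by
        simp only [Finset.mem_filter, Finset.mem_univ, true_and, Finset.mem_Iic] at hj ⊢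
        have : (c j : ℕ) ≤ c i := hc.monotone hj
        omega
    rw [Fin.card_Iic] at this
    omega

theorem colCount_le {n : ℕ} (c : Fin p → Fin n) : colCount q c ≤ p := by
  unfold colCount
  refine (Finset.sum_le_card_nsmul _ _ 1 fun i _ => ?_).trans (by simp)
  split_ifs <;> omega

theorem cornerDegree_diagExp {t : ℕ} (ht : 1 ≤ t) {c : Fin p → Fin (q + p)} (hc : StrictMono c) :
    cornerDegree t (diagExp c) = excess t q c := by
  have h1 : cornerDegree t (diagExp c) =
      ∑ i : Fin p, if (i : ℕ) ∈ Finset.Ico (t - 1) (colCount q c) then 1 else 0 := by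
    refine Finset.sum_congr rfl fun i _ => ?_
    rw [Finset.sum_eq_single (c i)]
    · rw [diagExp_apply]
      simp only [Finset.mem_Ico, lt_colCount_iff hc, true_and]
      split_ifs <;> first | rfl | omega
    · intro v _ hv
      rw [diagExp_apply, if_neg (fun h : c i = v ∧ _ => hv h.1.symm)]
      simp
    · simp
  rw [h1, Fin.sum_univ_eq_sum_range
    (fun i => if i ∈ Finset.Ico (t - 1) (colCount q c) then 1 else 0), ← Finset.card_filter,
    show (Finset.range p).filter (· ∈ Finset.Ico (t - 1) (colCount q c)) =
      Finset.Ico (t - 1) (colCount q c) from ?_, Nat.card_Ico, excess]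
  · omega
  · ext i
    have := colCount_le (q := q) c
    simp only [Finset.mem_filter, Finset.mem_range, Finset.mem_Ico]
    omega

theorem cornerDegree_sum_diagExp {t d : ℕ} (ht : 1 ≤ t) {e : Fin d → Fin p → Fin (q + p)}
    (he : IsStandard e) : cornerDegree t (∑ j, diagExp (e j)) = ∑ j, excess t q (e j) := by
  let f : ((Fin p ×ₗ Fin (q + p)) →₀ ℕ) →+ ℕ :=
    { toFun := cornerDegree t, map_zero' := by simp [cornerDegree],
      map_add' := cornerDegree_add t }
  refine (map_sum f (fun j => diagExp (e j)) Finset.univ).trans ?_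
  exact Finset.sum_congr rfl fun j _ => cornerDegree_diagExp ht (he.2 j)

end LeadingTerms

section Filtration

open MvPolynomial

variable (k : Type*) [Field k] (p q t : ℕ)

/-- The span of the `d`-fold products of maximal minors of `[X | 1]` of total excess at least
`n`. -/
noncomputable def excessSpan (d n : ℕ) : Submodule k (MvPolynomial (Fin p × Fin q) k) :=
  Submodule.span k ((fun c : Fin d → Fin p → Fin (q + p) =>
    ∏ j, colMinor (extGeneric k p q) (c j)) '' {c | n ≤ ∑ j, excess t q (c j)})

/-- The ideal generated by the products of maximal minors of `[X | 1]` of total excess at least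
`n`. -/
noncomputable def excessIdeal (n : ℕ) : Ideal (MvPolynomial (Fin p × Fin q) k) :=
  Ideal.span {f | ∃ (d : ℕ) (c : Fin d → Fin p → Fin (q + p)), n ≤ ∑ j, excess t q (c j) ∧
    ∏ j, colMinor (extGeneric k p q) (c j) = f}

variable {k p q t}

theorem prod_mem_excessSpan {d n : ℕ} (c : Fin d → Fin p → Fin (q + p))
    (hc : n ≤ ∑ j, excess t q (c j)) :
    ∏ j, colMinor (extGeneric k p q) (c j) ∈ excessSpan k p q t d n :=
  Submodule.subset_span ⟨c, hc, rfl⟩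

theorem excessSpan_le_standard (d n : ℕ) :
    excessSpan k p q t d n ≤ Submodule.span k ((fun e : Fin d → Fin p → Fin (q + p) =>
      ∏ j, colMinor (extGeneric k p q) (e j)) ''
        {e | IsStandard e ∧ n ≤ ∑ j, excess t q (e j)}) := by
  refine Submodule.span_le.2 ?_
  rintro _ ⟨c, hc, rfl⟩
  refine prod_colMinor_mem_of_standard (extGeneric k p q)
    (Submodule.toAddSubgroup (Submodule.span k _)) (fun e he1 he2 he3 => ?_) c hc
  exact Submodule.subset_span ⟨e, ⟨⟨he1, he2⟩, he3⟩, rfl⟩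

theorem mul_mem_excessSpan {d n d' n' : ℕ} {f g : MvPolynomial (Fin p × Fin q) k}
    (hf : f ∈ excessSpan k p q t d n) (hg : g ∈ excessSpan k p q t d' n') :
    f * g ∈ excessSpan k p q t (d + d') (n + n') := by
  have h := Submodule.mul_mem_mul hf hg
  rw [excessSpan, excessSpan, Submodule.span_mul_span] at h
  refine Submodule.span_mono ?_ h
  rintro _ ⟨_, ⟨c, hc, rfl⟩, _, ⟨c', hc', rfl⟩, rfl⟩
  refine ⟨Fin.append c c', ?_, ?_⟩
  · simp only [Set.mem_ofPred_eq, Fin.sum_univ_add, Fin.append_left, Fin.append_right] at hc hc' ⊢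
    omega
  · simp [Fin.prod_univ_add]

theorem colMinor_natAdd : colMinor (extGeneric k p q) (Fin.natAdd q) = 1 := by
  rw [colMinor, show (extGeneric k p q).submatrix id (Fin.natAdd q) = 1 from ?_, Matrix.det_one]
  ext1 i j
  simp [extGeneric, Matrix.one_apply]

theorem one_mem_excessSpan (d : ℕ) : 1 ∈ excessSpan k p q t d 0 := by
  have := prod_mem_excessSpan (k := k) (t := t) (n := 0) (fun _ : Fin d => Fin.natAdd (m := p) q)
    (Nat.zero_le _)
  simpa [colMinor_natAdd] using this

theorem excessSpan_mono {d d' n n' : ℕ} (hd : d ≤ d') (hn : n' ≤ n) :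
    excessSpan k p q t d n ≤ excessSpan k p q t d' n' := by
  intro f hf
  have h := mul_mem_excessSpan hf (one_mem_excessSpan (t := t) (d' - d))
  rw [mul_one, add_zero, Nat.add_sub_cancel' hd] at h
  exact Submodule.span_mono (Set.image_mono fun c hc => hn.trans hc) h

theorem colMinor_update_natAdd (i : Fin p) (v : Fin (q + p)) :
    colMinor (extGeneric k p q) (Function.update (Fin.natAdd q) i v) = extGeneric k p q i v := by
  have : (extGeneric k p q).submatrix id (Function.update (Fin.natAdd q) i v) =
      (1 : Matrix (Fin p) (Fin p) _).updateCol i fun l => extGeneric k p q l v := by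
    ext1 l j
    by_cases h : j = i
    · subst h; simp
    · simp [h, extGeneric, Matrix.one_apply]
  rw [colMinor, this, ← Matrix.cramer_apply, Matrix.cramer_one, Module.End.one_apply]

theorem exists_mem_excessSpan_zero (f : MvPolynomial (Fin p × Fin q) k) :
    ∃ d, f ∈ excessSpan k p q t d 0 := by
  induction f using MvPolynomial.induction_on with
  | C a =>
    refine ⟨0, ?_⟩
    rw [← mul_one (C a), ← smul_eq_C_mul]
    exact Submodule.smul_mem _ _ (one_mem_excessSpan 0)
  | add f g hf hg =>
    obtain ⟨d, hf⟩ := hf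
    obtain ⟨d', hg⟩ := hg
    exact ⟨max d d', add_mem (excessSpan_mono (le_max_left _ _) le_rfl hf)
      (excessSpan_mono (le_max_right _ _) le_rfl hg)⟩
  | mul_X f x hf =>
    obtain ⟨d, hf⟩ := hf
    have := prod_mem_excessSpan (k := k) (t := t) (n := 0)
      (fun _ : Fin 1 => Function.update (Fin.natAdd q) x.1 (Fin.castAdd p x.2)) (Nat.zero_le _)
    simp only [Finset.univ_unique, Finset.prod_singleton, colMinor_update_natAdd, extGeneric,
      Fin.addCases_left] at this
    have h := mul_mem_excessSpan hf this
    rw [add_zero] at h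
    exact ⟨d + 1, h⟩

theorem mem_excessIdeal_iff {n : ℕ} {f : MvPolynomial (Fin p × Fin q) k} :
    f ∈ excessIdeal k p q t n ↔ ∃ d, f ∈ excessSpan k p q t d n := by
  constructor
  · intro hf
    induction hf using Submodule.span_induction with
    | mem f hf =>
      obtain ⟨d, c, hc, rfl⟩ := hf
      exact ⟨d, prod_mem_excessSpan c hc⟩
    | zero => exact ⟨0, zero_mem _⟩
    | add f g _ _ hf hg =>
      obtain ⟨d, hf⟩ := hf
      obtain ⟨d', hg⟩ := hg
      exact ⟨max d d', add_mem (excessSpan_mono (le_max_left _ _) le_rfl hf)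
        (excessSpan_mono (le_max_right _ _) le_rfl hg)⟩
    | smul a f _ hf =>
      obtain ⟨d, hf⟩ := hf
      obtain ⟨d', ha⟩ := exists_mem_excessSpan_zero (t := t) a
      have := mul_mem_excessSpan ha hf
      rw [zero_add] at this
      exact ⟨d' + d, this⟩
  · rintro ⟨d, hf⟩
    refine (Submodule.span_le (p := (excessIdeal k p q t n).restrictScalars k)).2 ?_ hf
    rintro _ ⟨c, hc, rfl⟩
    exact Ideal.subset_span ⟨d, c, hc, rfl⟩

theorem excessIdeal_zero : excessIdeal k p q t 0 = ⊤ :=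
  (Ideal.eq_top_iff_one _).2 (mem_excessIdeal_iff.2 ⟨0, one_mem_excessSpan 0⟩)

theorem excessIdeal_antitone : Antitone (excessIdeal k p q t) := by
  intro m n hmn f hf
  obtain ⟨d, hf⟩ := mem_excessIdeal_iff.1 hf
  exact mem_excessIdeal_iff.2 ⟨d, excessSpan_mono le_rfl hmn hf⟩

theorem excessIdeal_pow_le (n : ℕ) : excessIdeal k p q t 1 ^ n ≤ excessIdeal k p q t n := by
  induction n with
  | zero => rw [excessIdeal_zero]; exact le_top
  | succ n ih =>
    rw [pow_succ]
    refine Ideal.mul_le.2 fun f hf g hg => ?_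
    obtain ⟨d, hf⟩ := mem_excessIdeal_iff.1 (ih hf)
    obtain ⟨d', hg⟩ := mem_excessIdeal_iff.1 hg
    exact mem_excessIdeal_iff.2 ⟨d + d', mul_mem_excessSpan hf hg⟩

/-- Splitting off the part of excess exactly `n`. -/
theorem exists_add_of_mem_excessSpan {d n : ℕ} {f : MvPolynomial (Fin p × Fin q) k}
    (hf : f ∈ excessSpan k p q t d n) :
    ∃ g ∈ Submodule.span k ((fun e : Fin d → Fin p → Fin (q + p) =>
      ∏ j, colMinor (extGeneric k p q) (e j)) '' {e | IsStandard e ∧ ∑ j, excess t q (e j) = n}),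
      f - g ∈ excessSpan k p q t d (n + 1) := by
  have hf' := excessSpan_le_standard d n hf
  have hset : {e : Fin d → Fin p → Fin (q + p) | IsStandard e ∧ n ≤ ∑ j, excess t q (e j)} =
      {e | IsStandard e ∧ ∑ j, excess t q (e j) = n} ∪
        {e | IsStandard e ∧ n + 1 ≤ ∑ j, excess t q (e j)} := by
    ext e
    simp only [Set.mem_ofPred_eq, Set.mem_union, ← and_or_left]
    exact and_congr_right fun _ => by omega
  rw [hset, Set.image_union, Submodule.span_union, Submodule.mem_sup] at hf'
  obtain ⟨g, hg, g', hg', rfl⟩ := hf'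
  refine ⟨g, hg, ?_⟩
  rw [add_sub_cancel_left]
  exact Submodule.span_mono (Set.image_mono fun e he => he.2) hg'

theorem exists_degree_unitriangularSubst {d : ℕ} {f : MvPolynomial (Fin p × Fin q) k}
    {s : Set (Fin d → Fin p → Fin (q + p))} (hs : ∀ e ∈ s, IsStandard e)
    (hf : f ∈ Submodule.span k ((fun e => ∏ j, colMinor (extGeneric k p q) (e j)) '' s))
    (hf0 : f ≠ 0) :
    unitriangularSubst k p q f ≠ 0 ∧ ∃ e ∈ s,
      MonomialOrder.lex.degree (unitriangularSubst k p q f) = ∑ j, diagExp (e j) := by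
  have h := MonomialOrder.exists_degree_eq_of_mem_span MonomialOrder.lex
    (unitriangularSubst k p q).toLinearMap _ s
    (fun e he => (prod_colMinor_leading k (hs e he)).2) ?_ hf hf0
  · obtain ⟨h1, e, he, h2⟩ := h
    exact ⟨h1, e, he, h2.trans (prod_colMinor_leading k (hs e he)).1⟩
  · intro e he e' he' heq
    refine sum_diagExp_injOn (hs e he) (hs e' he') ?_
    exact (prod_colMinor_leading k (hs e he)).1.symm.trans
      (heq.trans (prod_colMinor_leading k (hs e' he')).1)

/-- The associated graded ring of the filtration `excessIdeal` has no zero divisors of degree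
zero. -/
theorem mul_notMem_excessIdeal (ht : 1 ≤ t) {n : ℕ} {s f : MvPolynomial (Fin p × Fin q) k}
    (hs : s ∉ excessIdeal k p q t 1) (hf : f ∈ excessIdeal k p q t n)
    (hf' : f ∉ excessIdeal k p q t (n + 1)) : s * f ∉ excessIdeal k p q t (n + 1) := by
  intro hsf
  obtain ⟨d, hsd⟩ := exists_mem_excessSpan_zero (t := t) s
  obtain ⟨d', hfd⟩ := mem_excessIdeal_iff.1 hf
  obtain ⟨s₀, hs₀, hss⟩ := exists_add_of_mem_excessSpan hsd
  obtain ⟨f₀, hf₀, hff⟩ := exists_add_of_mem_excessSpan hfd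
  have hs0 : s₀ ≠ 0 := by
    rintro rfl
    exact hs (mem_excessIdeal_iff.2 ⟨d, by simpa using hss⟩)
  have hf0 : f₀ ≠ 0 := by
    rintro rfl
    exact hf' (mem_excessIdeal_iff.2 ⟨d', by simpa using hff⟩)
  have hprod : s₀ * f₀ ∈ excessIdeal k p q t (n + 1) := by
    have h1 : s₀ * (f - f₀) ∈ excessIdeal k p q t (n + 1) :=
      Ideal.mul_mem_left _ _ (mem_excessIdeal_iff.2 ⟨d', hff⟩)
    have h2 : (s - s₀) * f ∈ excessIdeal k p q t (n + 1) := by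
      have := mul_mem_excessSpan hss hfd
      rw [zero_add, add_comm 1 n] at this
      exact mem_excessIdeal_iff.2 ⟨_, this⟩
    have := sub_mem (sub_mem hsf h2) h1
    rwa [show s * f - (s - s₀) * f - s₀ * (f - f₀) = s₀ * f₀ by ring] at this
  obtain ⟨D, hD⟩ := mem_excessIdeal_iff.1 hprod
  obtain ⟨hs1, e, he, hse⟩ := exists_degree_unitriangularSubst (fun e he => he.1) hs₀ hs0
  obtain ⟨hf1, e', he', hfe⟩ := exists_degree_unitriangularSubst (fun e he => he.1) hf₀ hf0
  obtain ⟨-, e'', he'', hsfe⟩ := exists_degree_unitriangularSubst (fun e he => he.1)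
    (excessSpan_le_standard _ _ hD) (mul_ne_zero hs0 hf0)
  rw [map_mul, MonomialOrder.degree_mul hs1 hf1, hse, hfe] at hsfe
  have := congrArg (cornerDegree t) hsfe
  rw [cornerDegree_add, cornerDegree_sum_diagExp ht he.1, cornerDegree_sum_diagExp ht he'.1,
    cornerDegree_sum_diagExp ht he''.1, he.2, he'.2] at this
  have := he''.2
  omega

theorem mem_excessIdeal_of_mul_mem (ht : 1 ≤ t) {n : ℕ} {s f : MvPolynomial (Fin p × Fin q) k}
    (hs : s ∉ excessIdeal k p q t 1) (hsf : s * f ∈ excessIdeal k p q t n) :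
    f ∈ excessIdeal k p q t n := by
  induction n with
  | zero => rw [excessIdeal_zero]; trivial
  | succ n ih =>
    by_contra hf
    exact mul_notMem_excessIdeal ht hs (ih (excessIdeal_antitone n.le_succ hsf)) hf hsf

end Filtration

section DeterminantalIdeal

open MvPolynomial

theorem mem_symbolicPower_iff {R : Type*} [CommRing R] [IsNoetherianRing R] {I : Ideal R}
    (hI : I.IsPrime) {n : ℕ} {f : R} :
    f ∈ symbolicPower I n ↔ ∃ s, s ∉ I ∧ s * f ∈ I ^ n := by
  have h : associatedPrimes R (R ⧸ I) = {I} := by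
    rw [associatedPrimes.eq_singleton_of_isPrimary hI.isPrimary, hI.radical]
  change (∀ P ∈ associatedPrimes R (R ⧸ I), ∃ s, s ∉ P ∧ s * f ∈ I ^ n) ↔ _
  simp [h]

theorem exists_sumEquiv_inr {α β γ : Type*} [Fintype α] [Fintype β] [Fintype γ] {ρ : β → γ}
    (hρ : Function.Injective ρ) (hcard : Fintype.card α + Fintype.card β = Fintype.card γ) :
    ∃ e : α ⊕ β ≃ γ, ∀ b, e (Sum.inr b) = ρ b := by
  classical
  have h1 : Fintype.card α = Fintype.card ↥(Set.range ρ)ᶜ := by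
    rw [Fintype.card_compl_set, Set.card_range_of_injective hρ]
    omega
  let f : α ⊕ β ≃ ↥(Set.range ρ) ⊕ ↥(Set.range ρ)ᶜ :=
    (Equiv.sumComm _ _).trans ((Equiv.ofInjective ρ hρ).sumCongr (Fintype.equivOfCardEq h1))
  exact ⟨f.trans (Equiv.Set.sumCompl (Set.range ρ)), fun b => by simp [f]⟩

theorem colMinor_update_of_sum {R ι : Type*} [CommRing R] {p n : ℕ} (Z : Matrix (Fin p) (Fin n) R)
    (s : Finset ι) (r : R) (a : ι → R) (w : Fin n) (w' : ι → Fin n)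
    (h : ∀ i, r * Z i w = ∑ l ∈ s, a l * Z i (w' l)) (c : Fin p → Fin n) (j : Fin p) :
    r * colMinor Z (Function.update c j w) =
      ∑ l ∈ s, a l * colMinor Z (Function.update c j (w' l)) := by
  have hD : ∀ w, colMinor Z (Function.update c j w) =
      Matrix.detRowAlternating.toMultilinearMap.toLinearMap (fun l i => Z i (c l)) j
        (fun i => Z i w) := by
    intro w
    rw [colMinor_eq_detRowAlternating]
    refine congrArg Matrix.detRowAlternating ?_
    funext l i
    by_cases hl : l = j
    · subst hl; simp
    · simp [hl]
  simp only [hD, ← smul_eq_mul, ← map_smul, ← map_sum]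
  congr 1
  funext i
  simpa [Finset.sum_apply] using h i

theorem colCount_update {p n q : ℕ} (c : Fin p → Fin n) (j : Fin p) (w : Fin n) :
    colCount q (Function.update c j w) + (if (c j : ℕ) < q then 1 else 0) =
      colCount q c + if (w : ℕ) < q then 1 else 0 := by
  have h1 := Finset.sum_erase_add Finset.univ
    (fun i => if (c i : ℕ) < q then 1 else 0) (Finset.mem_univ j)
  have h2 := Finset.sum_erase_add Finset.univ
    (fun i => if (Function.update c j w i : ℕ) < q then 1 else 0) (Finset.mem_univ j)
  have h3 : ∑ i ∈ Finset.univ.erase j, (if (Function.update c j w i : ℕ) < q then 1 else 0) =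
      ∑ i ∈ Finset.univ.erase j, if (c i : ℕ) < q then 1 else 0 :=
    Finset.sum_congr rfl fun i hi => by rw [Function.update_of_ne (Finset.ne_of_mem_erase hi)]
  rw [h3] at h2
  simp only [Function.update_self] at h2
  unfold colCount
  rw [← h1, ← h2]
  omega

variable {k : Type*} [Field k] {p q t : ℕ}

theorem colMinor_laplace (c : Fin p → Fin (q + p)) (j : Fin p) (v : Fin q)
    (hv : c j = Fin.castAdd p v) :
    colMinor (extGeneric k p q) c = ∑ i, X (i, v) *
      colMinor (extGeneric k p q) (Function.update c j (Fin.natAdd q i)) := by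
  have := colMinor_update_of_sum (extGeneric k p q) Finset.univ 1 (fun i => X (i, v)) (c j)
    (fun i => Fin.natAdd q i) (fun i => ?_) c j
  · rwa [one_mul, Function.update_eq_self] at this
  · simp [hv, extGeneric]

theorem colCount_update_natAdd (c : Fin p → Fin (q + p)) {j : Fin p} (hj : (c j : ℕ) < q)
    (i : Fin p) : colCount q (Function.update c j (Fin.natAdd q i)) + 1 = colCount q c := by
  have := colCount_update (q := q) c j (Fin.natAdd q i)
  simpa [hj] using this

theorem exists_lt_of_colCount_pos {n : ℕ} {c : Fin p → Fin n} (hc : 0 < colCount q c) :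
    ∃ j, (c j : ℕ) < q := by
  by_contra! h
  simp [colCount, fun i => not_lt.2 (h i)] at hc

theorem colMinor_block {α β : Type*} [Fintype α] [Fintype β] [DecidableEq α] [DecidableEq β]
    (e : α ⊕ β ≃ Fin p) (ci : α → Fin q) :
    colMinor (extGeneric k p q) (Sum.elim (fun a => Fin.castAdd p (ci a))
      (fun b => Fin.natAdd q (e (Sum.inr b))) ∘ e.symm) =
      (Matrix.of fun a b : α => (X (e (Sum.inl a), ci b) : MvPolynomial (Fin p × Fin q) k)).det := by
  rw [colMinor, ← Matrix.det_submatrix_equiv_self e, Matrix.submatrix_submatrix]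
  have : (extGeneric k p q).submatrix (id ∘ e) ((Sum.elim (fun a => Fin.castAdd p (ci a))
      (fun b => Fin.natAdd q (e (Sum.inr b))) ∘ e.symm) ∘ e) =
      Matrix.fromBlocks (Matrix.of fun a b : α => X (e (Sum.inl a), ci b)) 0
        (Matrix.of fun (a : β) (b : α) => X (e (Sum.inr a), ci b)) 1 := by
    ext1 i j
    rcases i with i | i <;> rcases j with j | j <;> simp [extGeneric, Matrix.one_apply]
  rw [this, Matrix.det_fromBlocks_zero₁₂, Matrix.det_one, mul_one]

theorem genericMinors_subset_excessIdeal (htp : t ≤ p) :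
    genericMinors k p q t ⊆ excessIdeal k p q t 1 := by
  rintro _ ⟨ri, ci, hri, -, rfl⟩
  obtain ⟨e, he⟩ := exists_sumEquiv_inr (α := Fin (p - t)) hri (by simp; omega)
  have h := colMinor_block (k := k) ((Equiv.sumComm _ _).trans e) ci
  simp only [Equiv.trans_apply, Equiv.sumComm_apply, Sum.swap_inl, he] at h
  rw [← h]
  refine Ideal.subset_span ⟨1, fun _ => _, ?_, Fin.prod_univ_one _⟩
  rw [Fin.sum_univ_one, excess, colCount,
    ← Equiv.sum_comp ((Equiv.sumComm _ _).trans e), Fintype.sum_sum_type]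
  simp

theorem colMinor_mem_span_genericMinors_of_eq {c : Fin p → Fin (q + p)} (hc : colCount q c = t) :
    colMinor (extGeneric k p q) c ∈ Ideal.span (genericMinors k p q t) := by
  by_cases hinj : Function.Injective c
  swap
  · rw [colMinor_eq_zero_of_not_injective _ hinj]
    exact zero_mem _
  have hcardα : Fintype.card {i // (c i : ℕ) < q} = t := by
    rw [Fintype.card_subtype, Finset.card_filter]
    exact hc
  let ε : Fin t ≃ {i // (c i : ℕ) < q} := (Fintype.equivFinOfCardEq hcardα).symm
  let f : Fin t ⊕ {i // ¬ (c i : ℕ) < q} ≃ Fin p :=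
    (Equiv.sumCongr ε (Equiv.refl _)).trans (Equiv.sumCompl _)
  let ρ : {i // ¬ (c i : ℕ) < q} → Fin p := fun i => ⟨c i - q, by have := (c i).2; omega⟩
  have hcρ : ∀ i : {i // ¬ (c i : ℕ) < q}, c i = Fin.natAdd q (ρ i) := by
    intro i
    have := i.2
    ext
    simp only [ρ, Fin.val_natAdd]
    omega
  have hρ : Function.Injective ρ := fun i j hij =>
    Subtype.ext (hinj ((hcρ i).trans ((congrArg _ hij).trans (hcρ j).symm)))
  obtain ⟨e, he⟩ := exists_sumEquiv_inr (α := Fin t) hρ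
    (by rw [← Fintype.card_sum, Fintype.card_congr f])
  let ci : Fin t → Fin q := fun a => ⟨c (ε a), (ε a).2⟩
  have hci : Function.Injective ci := fun a b hab => by
    have : (c (ε a) : ℕ) = c (ε b) := congrArg (fun v : Fin q => (v : ℕ)) hab
    exact ε.injective (Subtype.ext (hinj (Fin.ext this)))
  have hcomp : c ∘ (e.symm.trans f) = Sum.elim (fun a => Fin.castAdd p (ci a))
      (fun b => Fin.natAdd q (e (Sum.inr b))) ∘ e.symm := by
    funext i
    obtain ⟨x, rfl⟩ := e.surjective i
    rcases x with a | b
    · simp [f, ci]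
    · simpa [f, ← he] using hcρ b
  have h := colMinor_block (k := k) e ci
  rw [← hcomp, colMinor_comp_perm] at h
  have hmem : (Matrix.of fun a b : Fin t =>
      (X (e (Sum.inl a), ci b) : MvPolynomial (Fin p × Fin q) k)).det ∈
        Ideal.span (genericMinors k p q t) :=
    Ideal.subset_span ⟨fun a => e (Sum.inl a), ci, e.injective.comp Sum.inl_injective, hci, rfl⟩
  rw [← h] at hmem
  rcases Int.units_eq_one_or (Equiv.Perm.sign (e.symm.trans f)) with h' | h' <;>
    simpa [h'] using hmem

theorem colMinor_mem_span_genericMinors {c : Fin p → Fin (q + p)} (hc : t ≤ colCount q c) :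
    colMinor (extGeneric k p q) c ∈ Ideal.span (genericMinors k p q t) := by
  obtain ⟨n, hn⟩ := Nat.exists_eq_add_of_le hc
  induction n generalizing c with
  | zero => exact colMinor_mem_span_genericMinors_of_eq hn
  | succ n ih =>
    obtain ⟨j, hj⟩ := exists_lt_of_colCount_pos (q := q) (c := c) (by omega)
    rw [colMinor_laplace c j ⟨c j, hj⟩ rfl]
    refine sum_mem fun i _ => Ideal.mul_mem_left _ _ ?_
    have := colCount_update_natAdd c hj i
    exact ih (by omega) (by omega)

theorem excessIdeal_one (htp : t ≤ p) :
    excessIdeal k p q t 1 = Ideal.span (genericMinors k p q t) := by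
  refine le_antisymm (Ideal.span_le.2 ?_) (Ideal.span_le.2 (genericMinors_subset_excessIdeal htp))
  rintro _ ⟨d, c, hc, rfl⟩
  obtain ⟨j, -, hj⟩ := Finset.exists_ne_zero_of_sum_ne_zero (Nat.pos_iff_ne_zero.1 hc)
  rw [← Finset.mul_prod_erase _ _ (Finset.mem_univ j)]
  refine Ideal.mul_mem_right _ _ (colMinor_mem_span_genericMinors ?_)
  unfold excess at hj
  omega

theorem eval_eq_zero_of_mem_span_genericMinors {M : Fin p × Fin q → k}
    (hM : ∀ (ri : Fin t → Fin p) (ci : Fin t → Fin q), Function.Injective ri →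
      Function.Injective ci → (Matrix.of fun a b => M (ri a, ci b)).det = 0)
    {f : MvPolynomial (Fin p × Fin q) k} (hf : f ∈ Ideal.span (genericMinors k p q t)) :
    eval M f = 0 := by
  refine RingHom.mem_ker.1 ((Ideal.span_le (I := RingHom.ker (eval M))).2 ?_ hf)
  rintro _ ⟨ri, ci, hri, hci, rfl⟩
  rw [SetLike.mem_coe, RingHom.mem_ker, RingHom.map_det, ← hM ri ci hri hci]
  congr 1
  ext a b
  simp

theorem isPrime_span_genericMinors (ht : 1 ≤ t) (htp : t ≤ p) :
    (Ideal.span (genericMinors k p q t)).IsPrime := by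
  refine ⟨fun h => ?_, fun {a b} hab => or_iff_not_imp_left.2 fun ha => ?_⟩
  · have : Nonempty (Fin t) := ⟨⟨0, ht⟩⟩
    have := eval_eq_zero_of_mem_span_genericMinors (M := 0) 
      (fun ri ci _ _ => (Matrix.det_zero : Matrix.det (0 : Matrix (Fin t) (Fin t) k) = 0))
      ((Ideal.eq_top_iff_one _).1 h)
    simp at this
  · rw [← excessIdeal_one htp] at hab ha ⊢
    exact mem_excessIdeal_of_mul_mem ht ha hab

theorem symbolicPower_le_excessIdeal (ht : 1 ≤ t) (htp : t ≤ p) (n : ℕ) :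
    symbolicPower (Ideal.span (genericMinors k p q t)) n ≤ excessIdeal k p q t n := by
  intro f hf
  obtain ⟨s, hs, hsf⟩ := (mem_symbolicPower_iff (isPrime_span_genericMinors ht htp)).1 hf
  rw [← excessIdeal_one htp] at hs hsf
  exact mem_excessIdeal_of_mul_mem ht hs (excessIdeal_pow_le n hsf)

end DeterminantalIdeal

section SymbolicPower

variable {R : Type*} [CommRing R] {I : Ideal R}

theorem symbolicPower_zero : symbolicPower I 0 = ⊤ := by
  refine (Ideal.eq_top_iff_one _).2 fun P hP => ⟨1, ?_, by simp⟩
  exact fun h => hP.1.ne_top ((Ideal.eq_top_iff_one P).2 h)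

theorem symbolicPower_mul_le (a b : ℕ) :
    symbolicPower I a * symbolicPower I b ≤ symbolicPower I (a + b) := by
  refine Ideal.mul_le.2 fun f hf g hg P hP => ?_
  obtain ⟨s, hs, hsf⟩ := hf P hP
  obtain ⟨u, hu, hug⟩ := hg P hP
  refine ⟨s * u, fun h => (hP.1.mem_or_mem h).elim hs hu, ?_⟩
  rw [pow_add, mul_mul_mul_comm]
  exact Ideal.mul_mem_mul hsf hug

/-- Distributing factors of a product greedily among `r + 1` groups. -/
theorem prod_mem_pow_mul_of_factors (M : Ideal R) (K : ℕ → Ideal R)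
    (hK : ∀ a b, K a * K b ≤ K (a + b)) {h m : ℕ} (hh : 1 ≤ h) (hm : 1 ≤ m) {d : ℕ} (f : Fin d → R)
    (g : Fin d → ℕ) (hg : ∀ j, g j ≤ h) (hf : ∀ j, ∀ e ≤ g j, f j ∈ M ^ e * K (g j - e))
    (r a e : ℕ) (ha : 1 ≤ a) (ham : a ≤ m) (hsum : e + a + r * m ≤ ∑ j, g j)
    (hsum' : a + (h - 1) + r * (m + (h - 1)) ≤ ∑ j, g j) :
    ∏ j, f j ∈ M ^ e * (K a * K m ^ r) := by
  induction d generalizing r a e with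
  | zero =>
    simp only [Finset.univ_eq_empty, Finset.sum_empty] at hsum
    omega
  | succ d ih =>
    rw [Fin.sum_univ_succ] at hsum hsum'
    rw [Fin.prod_univ_succ]
    have hrm : r * m ≤ r * (m + (h - 1)) := Nat.mul_le_mul_left _ (Nat.le_add_right _ _)
    have hg0 := hg 0
    have ih' := ih (fun j => f j.succ) (fun j => g j.succ) (fun j => hg j.succ)
      (fun j => hf j.succ)
    rcases lt_or_ge (g 0) a with hlt | hge
    · have h0 := hf 0 0 (Nat.zero_le _)
      rw [pow_zero, Ideal.one_eq_top, Ideal.top_mul, Nat.sub_zero] at h0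
      have h1 := ih' r (a - g 0) e (by omega) (by omega) (by omega) (by omega)
      have h2 := Ideal.mul_mem_mul h0 h1
      rw [mul_left_comm, ← mul_assoc (K (g 0))] at h2
      refine Ideal.mul_mono_right (Ideal.mul_mono_left ?_) h2
      have := hK (g 0) (a - g 0)
      rwa [Nat.add_sub_cancel' hlt.le] at this
    · have h0 := hf 0 (g 0 - a) (Nat.sub_le _ _)
      rw [Nat.sub_sub_self hge] at h0
      cases r with
      | zero =>
        rw [pow_zero, mul_one]
        have h1 : ∏ j : Fin d, f j.succ ∈ M ^ ∑ j : Fin d, g j.succ := by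
          rw [← Finset.prod_pow_eq_pow_sum]
          refine Ideal.prod_mem_prod fun j _ => ?_
          exact Ideal.mul_le_left (hf j.succ _ le_rfl)
        have h2 := Ideal.mul_mem_mul h0 h1
        rw [mul_right_comm, ← pow_add] at h2
        exact Ideal.mul_mono_left (Ideal.pow_le_pow_right (by omega)) h2
      | succ r =>
        rw [Nat.succ_mul] at hsum hsum' hrm
        rw [Nat.succ_mul] at hrm
        have hrm' : r * m ≤ r * (m + (h - 1)) := Nat.mul_le_mul_left _ (Nat.le_add_right _ _)
        have h1 := ih' r m (e - (g 0 - a)) hm le_rfl (by omega) (by omega)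
        have h2 := Ideal.mul_mem_mul h0 h1
        rw [mul_mul_mul_comm, ← pow_add, ← pow_succ'] at h2
        exact Ideal.mul_mono_left (Ideal.pow_le_pow_right (by omega)) h2

end SymbolicPower

section DeterminantalSymbolicPower

open MvPolynomial

variable {k : Type*} [Field k] {p q t : ℕ}

/-- Exchanging one column of `c` for a column of `b`, by Cramer's rule for `b`. -/
theorem colMinor_mul_colMinor {R : Type*} [CommRing R] {n : ℕ} (Z : Matrix (Fin p) (Fin n) R)
    (b c : Fin p → Fin n) (i : Fin p) :
    colMinor Z b * colMinor Z c = ∑ l, colMinor Z (Function.update b l (c i)) *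
      colMinor Z (Function.update c i (b l)) := by
  have h := colMinor_update_of_sum Z Finset.univ (colMinor Z b)
    (fun l => colMinor Z (Function.update b l (c i))) (c i) b (fun i' => ?_) c i
  · rwa [Function.update_eq_self] at h
  · have := congrFun (Matrix.mulVec_cramer (Z.submatrix id b) (fun i' => Z i' (c i))) i'
    rw [Pi.smul_apply, smul_eq_mul, Matrix.mulVec, dotProduct] at this
    refine this.symm.trans (Finset.sum_congr rfl fun l _ => ?_)
    rw [mul_comm, Matrix.cramer_apply]
    refine congrArg₂ _ (congrArg Matrix.det ?_) rfl
    ext x y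
    by_cases hy : y = l
    · subst hy; simp
    · simp [hy]

theorem colMinor_mul_pow_mem {b : Fin p → Fin (q + p)} (hb : colCount q b + 1 = t) (n : ℕ)
    {c : Fin p → Fin (q + p)} (hc : colCount q c = colCount q b + n)
    (hbc : ∀ j, (b j : ℕ) < q → ∃ i, c i = b j) :
    colMinor (extGeneric k p q) c * colMinor (extGeneric k p q) b ^ n ∈
      Ideal.span (genericMinors k p q t) ^ n := by
  induction n generalizing c with
  | zero => simp
  | succ n ih =>
    by_cases hinj : Function.Injective c
    swap
    · rw [colMinor_eq_zero_of_not_injective _ hinj, zero_mul]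
      exact zero_mem _
    obtain ⟨i, hi, hib⟩ : ∃ i, (c i : ℕ) < q ∧ ∀ j, b j ≠ c i := by
      by_contra! h
      have hex : ∀ i, ∃ j, (c i : ℕ) < q → b j = c i := fun i => by
        by_cases hi : (c i : ℕ) < q
        · exact (h i hi).imp fun j hj _ => hj
        · exact ⟨i, fun h => absurd h hi⟩
      choose g hg using hex
      have := Finset.card_le_card_of_injOn (s := Finset.univ.filter fun i => (c i : ℕ) < q)
        (t := Finset.univ.filter fun j => (b j : ℕ) < q) g (fun i hi => by
          simp only [Finset.coe_filter, Finset.mem_univ, true_and, Set.mem_ofPred_eq] at hi ⊢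
          rwa [hg i hi]) (fun i hi i' hi' h => by
          simp only [Finset.coe_filter, Finset.mem_univ, true_and, Set.mem_ofPred_eq] at hi hi'
          exact hinj ((hg i hi).symm.trans ((congrArg b h).trans (hg i' hi'))))
      rw [Finset.card_filter, Finset.card_filter] at this
      unfold colCount at hc
      omega
    rw [pow_succ' (colMinor _ b), ← mul_assoc, mul_comm (colMinor _ c),
      colMinor_mul_colMinor _ b c i, Finset.sum_mul]
    refine sum_mem fun l _ => ?_
    rw [mul_assoc, pow_succ']
    have hold : ∀ j, (b j : ℕ) < q → ∃ i', i' ≠ i ∧ c i' = b j := by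
      intro j hj
      obtain ⟨i', hi'⟩ := hbc j hj
      exact ⟨i', fun h => hib j (by rw [← hi', h]), hi'⟩
    by_cases hl : (b l : ℕ) < q
    · obtain ⟨i', hi', hcl⟩ := hold l hl
      rw [colMinor_eq_zero_of_not_injective (c := Function.update c i (b l)), zero_mul, mul_zero]
      · exact zero_mem _
      · refine fun h => hi' (h ?_)
        rw [Function.update_of_ne hi', Function.update_self, hcl]
    · have h1 := colCount_update (q := q) b l (c i)
      have h2 := colCount_update (q := q) c i (b l)
      rw [if_neg hl, if_pos hi] at h1 h2
      refine Ideal.mul_mem_mul (colMinor_mem_span_genericMinors (by omega))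
        (ih (by omega) fun j hj => ?_)
      obtain ⟨i', hi', hcj⟩ := hold j hj
      exact ⟨i', by rw [Function.update_of_ne hi', hcj]⟩

theorem exists_colMinor_notMem {c : Fin p → Fin (q + p)} (hc : Function.Injective c) (ht : 1 ≤ t)
    (hct : t ≤ colCount q c) : ∃ b : Fin p → Fin (q + p), colCount q b + 1 = t ∧
      (∀ j, (b j : ℕ) < q → ∃ i, c i = b j) ∧
      colMinor (extGeneric k p q) b ∉ Ideal.span (genericMinors k p q t) := by
  obtain ⟨S, hS, hcard⟩ := Finset.exists_subset_card_eq
    (s := Finset.univ.filter fun i => (c i : ℕ) < q) (n := t - 1)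
    (by rw [Finset.card_filter]; unfold colCount at hct; omega)
  have hSq : ∀ i ∈ S, (c i : ℕ) < q := fun i hi => (Finset.mem_filter.1 (hS hi)).2
  let b : Fin p → Fin (q + p) := fun i => if i ∈ S then c i else Fin.natAdd q i
  have hb : ∀ i, (b i : ℕ) < q ↔ i ∈ S := by
    intro i
    by_cases hi : i ∈ S <;> simp [b, hi, hSq]
  refine ⟨b, ?_, fun j hj => ⟨j, by simp [b, (hb j).1 hj]⟩, fun hmem => ?_⟩
  · have : colCount q b = S.card := by
      unfold colCount
      simp [hb]
    omega
  · let M : Fin p × Fin q → k := fun x => if x.1 ∈ S ∧ c x.1 = Fin.castAdd p x.2 then 1 else 0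
    have h0 := eval_eq_zero_of_mem_span_genericMinors (M := M) (fun ri ci hri _ => ?_) hmem
    · have h1 : (eval M).mapMatrix ((extGeneric k p q).submatrix id b) = 1 := by
        ext1 i j
        simp only [RingHom.mapMatrix_apply, Matrix.map_apply, Matrix.submatrix_apply, id_eq]
        by_cases hj : j ∈ S
        · have hcj : b j = Fin.castAdd p ⟨c j, hSq j hj⟩ := by simp [b, hj]
          rw [hcj, extGeneric, Fin.addCases_left, eval_X, Matrix.one_apply]
          refine if_congr ⟨fun h => hc h.2, ?_⟩ rfl rfl
          rintro rfl
          exact ⟨hj, rfl⟩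
        · have hcj : b j = Fin.natAdd q j := by simp [b, hj]
          rw [hcj, extGeneric, Fin.addCases_right, Matrix.one_apply]
          split_ifs <;> simp
      rw [colMinor, RingHom.map_det, h1, Matrix.det_one] at h0
      exact one_ne_zero h0
    · obtain ⟨a, ha⟩ : ∃ a, ri a ∉ S := by
        by_contra! h
        have := Finset.card_le_card_of_injOn (s := Finset.univ) (t := S) ri
          (fun a _ => h a) hri.injOn
        rw [Finset.card_univ, Fintype.card_fin] at this
        omega
      exact Matrix.det_eq_zero_of_row_eq_zero a fun b => by simp [M, ha]

theorem colMinor_mem_symbolicPower (ht : 1 ≤ t) (htp : t ≤ p) (c : Fin p → Fin (q + p)) :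
    colMinor (extGeneric k p q) c ∈
      symbolicPower (Ideal.span (genericMinors k p q t)) (excess t q c) := by
  have hI := isPrime_span_genericMinors (k := k) (q := q) ht htp
  by_cases hinj : Function.Injective c
  swap
  · rw [colMinor_eq_zero_of_not_injective _ hinj]
    exact zero_mem _
  by_cases hct : t ≤ colCount q c
  · obtain ⟨b, hb, hbc, hmem⟩ := exists_colMinor_notMem (k := k) hinj ht hct
    refine (mem_symbolicPower_iff hI).2 ⟨colMinor (extGeneric k p q) b ^ excess t q c,
      fun h => hmem (hI.mem_of_pow_mem _ h), ?_⟩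
    rw [mul_comm]
    exact colMinor_mul_pow_mem hb _ (by unfold excess; omega) hbc
  · rw [show excess t q c = 0 by unfold excess; omega, symbolicPower_zero]
    trivial

theorem colMinor_mem_pow_mul_symbolicPower (ht : 1 ≤ t) (htp : t ≤ p) (e : ℕ)
    (c : Fin p → Fin (q + p)) (he : e ≤ excess t q c) :
    colMinor (extGeneric k p q) c ∈
      Ideal.span (Set.range (X : Fin p × Fin q → MvPolynomial (Fin p × Fin q) k)) ^ e *
        symbolicPower (Ideal.span (genericMinors k p q t)) (excess t q c - e) := by
  induction e generalizing c with
  | zero => simpa using colMinor_mem_symbolicPower ht htp c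
  | succ e ih =>
    obtain ⟨j, hj⟩ := exists_lt_of_colCount_pos (q := q) (c := c) (by unfold excess at he; omega)
    rw [colMinor_laplace c j ⟨c j, hj⟩ rfl]
    refine sum_mem fun i _ => ?_
    have hcount := colCount_update_natAdd c hj i
    have hex : excess t q (Function.update c j (Fin.natAdd q i)) + 1 = excess t q c := by
      unfold excess at he ⊢
      omega
    rw [pow_succ', mul_assoc, ← hex, Nat.add_sub_add_right]
    exact Ideal.mul_mem_mul (Ideal.subset_span ⟨_, rfl⟩) (ih _ (by omega))

end DeterminantalSymbolicPower

/-- **Theorem `determinantal case thm`.** Let `I = I_t(X)` be the ideal of `t`-minors of a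
generic `p×q` matrix of indeterminates, of height `h = (p−t+1)(q−t+1)`.  Then for all
`m, r ≥ 1`, `I^{(r(h+m−1))} ⊆ 𝔪^{r(h−1)} (I^{(m)})^r`. -/
theorem stmt_12 {k : Type*} [Field k] (p q t : ℕ) (ht : 1 ≤ t) (htp : t ≤ p) (htq : t ≤ q)
    (h : ℕ) (hh : h = (p - t + 1) * (q - t + 1)) :
    ∀ m r : ℕ, 1 ≤ m → 1 ≤ r →
      symbolicPower (Ideal.span (genericMinors k p q t)) (r * (h + m - 1)) ≤
        (Ideal.span (Set.range
            (MvPolynomial.X : Fin p × Fin q → MvPolynomial (Fin p × Fin q) k))) ^ (r * (h - 1)) *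
          (symbolicPower (Ideal.span (genericMinors k p q t)) m) ^ r := by
  intro m r hm hr
  have hph : p - t + 1 ≤ h := hh ▸ Nat.le_mul_of_pos_right _ (Nat.succ_pos _)
  refine (symbolicPower_le_excessIdeal ht htp _).trans (Ideal.span_le.2 ?_)
  rintro _ ⟨d, c, hc, rfl⟩
  obtain ⟨r, rfl⟩ := Nat.exists_eq_add_of_le' hr
  rw [Nat.sub_add_comm (by omega), Nat.add_comm (h - 1) m] at hc
  rw [pow_succ']
  refine prod_mem_pow_mul_of_factors (h := h) _ _ symbolicPower_mul_le (by omega) hm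
    (fun j => colMinor (extGeneric k p q) (c j)) (fun j => excess t q (c j)) (fun j => ?_)
    (fun j e he => colMinor_mem_pow_mul_symbolicPower ht htp e (c j) he) r m _ hm le_rfl ?_ ?_
  · have := colCount_le (q := q) (c j)
    unfold excess
    omega
  · refine le_trans (le_of_eq ?_) hc
    ring
  · refine le_trans (le_of_eq ?_) hc
    ring
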